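/- (Theorem 3.4, symplectic Runge–Kutta SAV energy conservation, fully discrete.) Let s ≥ 1 and let a : Fin s → Fin s → ℝ, b : Fin s → ℝ satisfy b_i·a_{i,j} + b_j·a_{j,i} = b_i·b_j for all i, j. Let τ ∈ ℝ, C0 ∈ ℝ, u⁰ : Fin N → ℝ, v⁰ ∈ ℝ, and let real stage values U_i : Fin N → ℝ and V_i ∈ ℝ (i ∈ Fin s) satisfy the positivity condition Re(⟨U_i^{∘m}, U_i⟩_h) + C0 > 0 for each i, together with the coupled stage equations in ℂ: U_i = u⁰ + τ·Σ_j a_{i,j}·f_SAV(U_j, V_j) and V_i = v⁰ + τ·Σ_j a_{i,j}·g_SAV(U_j, V_j). Define u¹ := u⁰ + τ·Σ_i b_i·f_SAV(U_i, V_i) ∈ (Fin N → ℂ) and v¹ := v⁰ + τ·Σ_i b_i·g_SAV(U_i, V_i) ∈ ℂ. Then the modified discrete energy is conserved: Re(Ẽ_h(u¹, v¹)) = Re(Ẽ_h(u⁰, v⁰)). -/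

import Mathlib

open Matrix Complex BigOperators

noncomputable section

/-- The shifted integer index `k̂ = k - N/2` associated to `k ∈ Fin N`. -/
def khat (N : ℕ) (k : Fin N) : ℤ := (k : ℤ) - (N : ℤ) / 2

/-- The collocation angles `θ_j = 2π ĵ / N`. -/
def theta (N : ℕ) (j : Fin N) : ℝ := 2 * Real.pi * (khat N j : ℝ) / N

/-- The discrete Fourier matrix `F`, `F_{k,j} = (1/N) exp(-i k̂ θ_j)`. -/
def Fm (N : ℕ) : Matrix (Fin N) (Fin N) ℂ :=
  Matrix.of fun k j => (N : ℂ)⁻¹ * Complex.exp (-Complex.I * (khat N k : ℂ) * (theta N j : ℂ))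

/-- The inverse discrete Fourier matrix `G`, `G_{j,k} = exp(i k̂ θ_j)`. -/
def Gm (N : ℕ) : Matrix (Fin N) (Fin N) ℂ :=
  Matrix.of fun j k => Complex.exp (Complex.I * (khat N k : ℂ) * (theta N j : ℂ))

/-- The diagonal weight matrix `P = diag(α - i x_j)`. -/
def Pm (N : ℕ) (α : ℝ) (x : Fin N → ℝ) : Matrix (Fin N) (Fin N) ℂ :=
  Matrix.diagonal fun j => (α : ℂ) - Complex.I * (x j : ℂ)

/-- The diagonal matrix `P⁻¹ = diag((α - i x_j)⁻¹)`. -/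
def PinvM (N : ℕ) (α : ℝ) (x : Fin N → ℝ) : Matrix (Fin N) (Fin N) ℂ :=
  Matrix.diagonal fun j => ((α : ℂ) - Complex.I * (x j : ℂ))⁻¹

/-- The diagonal matrix `P̄ = diag(α + i x_j)`. -/
def PbarM (N : ℕ) (α : ℝ) (x : Fin N → ℝ) : Matrix (Fin N) (Fin N) ℂ :=
  Matrix.diagonal fun j => (α : ℂ) + Complex.I * (x j : ℂ)

/-- The discrete Hilbert transform matrix `H = diag(-i sgn(k̂))` with `sgn(0) = 1`. -/
def Hm (N : ℕ) : Matrix (Fin N) (Fin N) ℂ :=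
  Matrix.diagonal fun k => if 0 ≤ khat N k then -Complex.I else Complex.I

/-- The tridiagonal differentiation matrix `S1`:
`(S1)_{k,k-1} = i k̂/(2α)`, `(S1)_{k,k} = i (2k̂+1)/(2α)`, `(S1)_{k,k+1} = i (k̂+1)/(2α)`. -/
def S1 (N : ℕ) (α : ℝ) : Matrix (Fin N) (Fin N) ℂ :=
  Matrix.of fun k l =>
    if (l : ℤ) = (k : ℤ) - 1 then Complex.I * (khat N k : ℂ) / (2 * (α : ℂ))
    else if (l : ℤ) = (k : ℤ) then Complex.I * (2 * (khat N k : ℂ) + 1) / (2 * (α : ℂ))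
    else if (l : ℤ) = (k : ℤ) + 1 then Complex.I * ((khat N k : ℂ) + 1) / (2 * (α : ℂ))
    else 0

/-- The second-derivative matrix `S2 = S1 · S1`. -/
def S2 (N : ℕ) (α : ℝ) : Matrix (Fin N) (Fin N) ℂ := S1 N α * S1 N α

/-- The discrete inner product `⟨u,v⟩_h = (π/(Nα)) Σ_j (α² + x_j²) u_j conj(v_j)`. -/
def iph (N : ℕ) (α : ℝ) (x : Fin N → ℝ) (u v : Fin N → ℂ) : ℂ :=
  ((Real.pi / (N * α) : ℝ) : ℂ) *
    ∑ j, ((α ^ 2 + x j ^ 2 : ℝ) : ℂ) * u j * (starRingEnd ℂ) (v j)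

/-- The conjugated first-derivative operator `B_{S1} = P⁻¹ G S1 F P`. -/
def BS1 (N : ℕ) (α : ℝ) (x : Fin N → ℝ) : Matrix (Fin N) (Fin N) ℂ :=
  PinvM N α x * Gm N * S1 N α * Fm N * Pm N α x

/-- The conjugated operator `B_{HS1} = P⁻¹ G H S1 F P`. -/
def BHS1 (N : ℕ) (α : ℝ) (x : Fin N → ℝ) : Matrix (Fin N) (Fin N) ℂ :=
  PinvM N α x * Gm N * Hm N * S1 N α * Fm N * Pm N α x

/-- The conjugated dispersion operator `B_{HS2} = P⁻¹ G H S2 F P`. -/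
def BHS2 (N : ℕ) (α : ℝ) (x : Fin N → ℝ) : Matrix (Fin N) (Fin N) ℂ :=
  PinvM N α x * Gm N * Hm N * S2 N α * Fm N * Pm N α x

/-- Coercion of a real vector into a complex vector. -/
def cv (N : ℕ) (u : Fin N → ℝ) : Fin N → ℂ := fun j => (u j : ℂ)

/-- Entrywise `m`-th power of a complex vector. -/
def pw (N : ℕ) (m : ℕ) (u : Fin N → ℂ) : Fin N → ℂ := fun j => u j ^ m

/-- The mass-conservative semi-discrete right-hand side
`f_M(w) = B_{HS2} w - (1/(m+1)) (w^{∘(m-1)} ⊙ (B_{S1} w) + B_{S1}(w^{∘m}))`. -/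
def fM (N : ℕ) (α : ℝ) (x : Fin N → ℝ) (m : ℕ) (w : Fin N → ℂ) : Fin N → ℂ :=
  fun j => (BHS2 N α x *ᵥ w) j
    - (1 / ((m : ℂ) + 1)) *
        ((w j) ^ (m - 1) * (BS1 N α x *ᵥ w) j + (BS1 N α x *ᵥ pw N m w) j)

/-- The energy-conservative semi-discrete right-hand side
`f_E(w) = -B_{S1}(-B_{HS1} w + (1/m) w^{∘m})`. -/
def fE (N : ℕ) (α : ℝ) (x : Fin N → ℝ) (m : ℕ) (w : Fin N → ℂ) : Fin N → ℂ :=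
  -(BS1 N α x *ᵥ (-(BHS1 N α x *ᵥ w) + (1 / (m : ℂ)) • pw N m w))

/-- The semi-discrete energy
`E_h(w) = (1/2)⟨B_{HS1} w, w⟩_h - (1/(m(m+1)))⟨w^{∘m}, w⟩_h`. -/
def Eh (N : ℕ) (α : ℝ) (x : Fin N → ℝ) (m : ℕ) (w : Fin N → ℂ) : ℂ :=
  (1 / 2 : ℂ) * iph N α x (BHS1 N α x *ᵥ w) w
    - (1 / ((m : ℂ) * ((m : ℂ) + 1))) * iph N α x (pw N m w) w

end

noncomputable section

/-- `r(u) = Re⟨u^{∘m}, u⟩_h + C0` for a real vector `u`. -/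
def rSAV (N : ℕ) (α : ℝ) (x : Fin N → ℝ) (m : ℕ) (C0 : ℝ) (u : Fin N → ℝ) : ℝ :=
  (iph N α x (pw N m (cv N u)) (cv N u)).re + C0

/-- The SAV-reformulated right-hand side
`f_SAV(u,v) = -B_{S1}(-B_{HS1} u + (1/m)(v/√(r(u))) u^{∘m})`. -/
def fSAV (N : ℕ) (α : ℝ) (x : Fin N → ℝ) (m : ℕ) (C0 : ℝ)
    (u : Fin N → ℝ) (v : ℝ) : Fin N → ℂ :=
  -(BS1 N α x *ᵥ (-(BHS1 N α x *ᵥ cv N u)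
      + ((1 / (m : ℂ)) * ((v : ℂ) / (Real.sqrt (rSAV N α x m C0 u) : ℂ))) • pw N m (cv N u)))

/-- The SAV auxiliary right-hand side
`g_SAV(u,v) = ((m+1)/(2√(r(u)))) ⟨u^{∘m}, f_SAV(u,v)⟩_h`. -/
def gSAV (N : ℕ) (α : ℝ) (x : Fin N → ℝ) (m : ℕ) (C0 : ℝ)
    (u : Fin N → ℝ) (v : ℝ) : ℂ :=
  ((((m : ℝ) + 1) / (2 * Real.sqrt (rSAV N α x m C0 u)) : ℝ) : ℂ) *
    iph N α x (pw N m (cv N u)) (fSAV N α x m C0 u v)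

/-- The modified discrete energy
`Ẽ_h(u,v) = (1/2)⟨B_{HS1} u, u⟩_h - (1/(m(m+1)))(v² - C0)`. -/
def EhSAV (N : ℕ) (α : ℝ) (x : Fin N → ℝ) (m : ℕ) (C0 : ℝ)
    (u : Fin N → ℂ) (v : ℂ) : ℂ :=
  (1 / 2 : ℂ) * iph N α x (BHS1 N α x *ᵥ u) u
    - (1 / ((m : ℂ) * ((m : ℂ) + 1))) * (v ^ 2 - (C0 : ℂ))

end

/-- A Runge–Kutta step whose coefficients satisfy the symplecticity condition changes a
quadratic form by the weighted sum of its derivatives along the stages. -/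
theorem symplectic_rungeKutta_quadratic {E ι : Type*} [AddCommGroup E] [Module ℝ E] [Fintype ι]
    {Φ : LinearMap.BilinForm ℝ E} (hΦ : ∀ y z, Φ y z = Φ z y)
    {a : ι → ι → ℝ} {b : ι → ℝ} (hab : ∀ i j, b i * a i j + b j * a j i = b i * b j)
    (τ : ℝ) (y₀ : E) {k Y : ι → E} (hY : ∀ i, Y i = y₀ + τ • ∑ j, a i j • k j) :
    Φ (y₀ + τ • ∑ i, b i • k i) (y₀ + τ • ∑ i, b i • k i)
      = Φ y₀ y₀ + 2 * τ * ∑ i, b i * Φ (k i) (Y i) := by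
  have hsymm : ∑ i, ∑ j, b i * b j * Φ (k i) (k j)
      = 2 * ∑ i, ∑ j, b i * a i j * Φ (k i) (k j) := by
    have hswap : ∑ i, ∑ j, b i * a i j * Φ (k i) (k j)
        = ∑ i, ∑ j, b j * a j i * Φ (k i) (k j) := by
      rw [Finset.sum_comm]
      exact Finset.sum_congr rfl fun i _ => Finset.sum_congr rfl fun j _ => by
        rw [hΦ (k j) (k i)]
    rw [two_mul]
    nth_rewrite 2 [hswap]
    simp only [← Finset.sum_add_distrib, ← add_mul, hab]
  have hstage : ∑ i, b i * Φ (k i) (Y i)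
      = ∑ i, b i * Φ (k i) y₀ + τ * ∑ i, ∑ j, b i * a i j * Φ (k i) (k j) := by
    simp only [hY, map_add, map_smul, map_sum, smul_eq_mul, mul_add, Finset.sum_add_distrib,
      Finset.mul_sum]
    congr 1
    exact Finset.sum_congr rfl fun i _ => Finset.sum_congr rfl fun j _ => by ring
  have hlin : Φ (∑ i, b i • k i) y₀ = ∑ i, b i * Φ (k i) y₀ := by
    simp [LinearMap.sum_apply]
  have hquad : Φ (∑ i, b i • k i) (∑ i, b i • k i)
      = ∑ i, ∑ j, b i * b j * Φ (k i) (k j) := by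
    simp only [map_sum, LinearMap.sum_apply, map_smul, LinearMap.smul_apply, smul_eq_mul,
      Finset.mul_sum]
    rw [Finset.sum_comm]
    exact Finset.sum_congr rfl fun i _ => Finset.sum_congr rfl fun j _ => by ring
  simp only [map_add, LinearMap.add_apply, map_smul, LinearMap.smul_apply, smul_eq_mul]
  rw [hΦ y₀ (∑ i, b i • k i), hstage, hlin, hquad, hsymm]
  ring

theorem iph_conj_symm (N : ℕ) (α : ℝ) (x : Fin N → ℝ) (u v : Fin N → ℂ) :
    (starRingEnd ℂ) (iph N α x u v) = iph N α x v u := by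
  simp only [iph, map_mul, map_sum, Complex.conj_ofReal, Complex.conj_conj]
  congr 1
  exact Finset.sum_congr rfl fun j _ => by ring

theorem iph_eq_star_dotProduct (N : ℕ) (α : ℝ) (x : Fin N → ℝ) (u v : Fin N → ℂ) :
    iph N α x u v
      = ((Real.pi / (N * α) : ℝ) : ℂ) * (star (Pm N α x *ᵥ v) ⬝ᵥ Pm N α x *ᵥ u) := by
  simp only [iph, Pm, dotProduct, mulVec_diagonal, Pi.star_apply, star_mul', star_sub,
    Complex.star_def, Complex.conj_ofReal, Complex.conj_I]
  congr 1
  refine Finset.sum_congr rfl fun j _ => ?_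
  push_cast
  linear_combination ((x j : ℂ) ^ 2 * u j * (starRingEnd ℂ) (v j)) * Complex.I_sq

theorem Pm_mul_PinvM (N : ℕ) {α : ℝ} (hα : α ≠ 0) (x : Fin N → ℝ) :
    Pm N α x * PinvM N α x = 1 := by
  rw [Pm, PinvM, diagonal_mul_diagonal, ← diagonal_one]
  congr 1
  funext j
  refine mul_inv_cancel₀ fun h => hα ?_
  simpa using congrArg Complex.re h

theorem Gm_eq_smul_conjTranspose_Fm {N : ℕ} (hN0 : N ≠ 0) : Gm N = (N : ℂ) • (Fm N)ᴴ := by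
  have hN : (N : ℂ) ≠ 0 := by exact_mod_cast hN0
  ext j k
  simp [Gm, Fm, ← Complex.exp_conj, hN]

/-- Conjugation of an operator on Fourier coefficients to an operator on collocation values. -/
noncomputable def fourierConj (N : ℕ) (α : ℝ) (x : Fin N → ℝ) (M : Matrix (Fin N) (Fin N) ℂ) :
    Matrix (Fin N) (Fin N) ℂ :=
  PinvM N α x * Gm N * M * Fm N * Pm N α x

theorem iph_fourierConj_mulVec {N : ℕ} (hN0 : N ≠ 0) {α : ℝ} (hα : α ≠ 0) (x : Fin N → ℝ)
    (M : Matrix (Fin N) (Fin N) ℂ) (u v : Fin N → ℂ) :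
    iph N α x (fourierConj N α x M *ᵥ u) v
      = ((Real.pi / (N * α) : ℝ) : ℂ) * ((N : ℂ) *
        (star ((Fm N * Pm N α x) *ᵥ v) ⬝ᵥ M *ᵥ ((Fm N * Pm N α x) *ᵥ u))) := by
  have hfactor : Pm N α x * fourierConj N α x M
      = (N : ℂ) • ((Fm N)ᴴ * (M * (Fm N * Pm N α x))) := by
    rw [fourierConj, Gm_eq_smul_conjTranspose_Fm hN0]
    simp only [← Matrix.mul_assoc, Pm_mul_PinvM N hα x, Matrix.one_mul, Matrix.smul_mul,
      Matrix.mul_smul]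
  rw [iph_eq_star_dotProduct, mulVec_mulVec, hfactor, smul_mulVec, dotProduct_smul, smul_eq_mul,
    ← mulVec_mulVec, ← mulVec_mulVec, dotProduct_mulVec _ (Fm N)ᴴ, ← star_mulVec,
    mulVec_mulVec v]

theorem iph_fourierConj_adjoint {N : ℕ} (hN0 : N ≠ 0) {α : ℝ} (hα : α ≠ 0) (x : Fin N → ℝ)
    (M : Matrix (Fin N) (Fin N) ℂ) (u v : Fin N → ℂ) :
    iph N α x (fourierConj N α x M *ᵥ u) v = iph N α x u (fourierConj N α x Mᴴ *ᵥ v) := by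
  rw [← iph_conj_symm N α x (fourierConj N α x Mᴴ *ᵥ v) u, iph_fourierConj_mulVec hN0 hα,
    iph_fourierConj_mulVec hN0 hα, map_mul, map_mul, Complex.conj_ofReal, Complex.conj_natCast,
    ← Complex.star_def, ← star_dotProduct_star, star_star, star_mulVec Mᴴ,
    conjTranspose_conjTranspose, ← dotProduct_mulVec]

theorem conjTranspose_S1 (N : ℕ) (α : ℝ) : (S1 N α)ᴴ = -S1 N α := by
  ext k l
  simp only [S1, khat, conjTranspose_apply, Matrix.neg_apply, Matrix.of_apply]
  split_ifs <;> first
    | omega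
    | (have hkl : ((k : ℤ) : ℂ) = (l : ℤ) + 1 := by
        exact_mod_cast (by omega : (k : ℤ) = (l : ℤ) + 1)
       simp at hkl
       simp [hkl]
       ring)
    | (have hkl : ((l : ℤ) : ℂ) = (k : ℤ) + 1 := by
        exact_mod_cast (by omega : (l : ℤ) = (k : ℤ) + 1)
       simp at hkl
       simp [hkl]
       ring)
    | (have hkl : k = l := Fin.ext (by omega)
       simp [hkl]
       ring)
    | simp

theorem Hm_commute_S1 (N : ℕ) (α : ℝ) : Hm N * S1 N α = S1 N α * Hm N := by
  ext k l
  rw [Hm, diagonal_mul, mul_diagonal]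
  by_cases hkl : 0 ≤ khat N k ↔ 0 ≤ khat N l
  · simp only [hkl, mul_comm]
  · have hzero : S1 N α k l = 0 := by
      simp only [S1, Matrix.of_apply]
      unfold khat at hkl ⊢
      split_ifs
      · rw [show (k : ℤ) - (N : ℤ) / 2 = 0 by omega]
        simp
      · omega
      · rw [show (k : ℤ) - (N : ℤ) / 2 = -1 by omega]
        simp
      · rfl
    rw [hzero, mul_zero, zero_mul]

theorem conjTranspose_Hm (N : ℕ) : (Hm N)ᴴ = -Hm N := by
  rw [Hm, diagonal_conjTranspose, diagonal_neg]
  congr 1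
  funext k
  by_cases h : 0 ≤ khat N k <;> simp [h]

theorem conjTranspose_Hm_mul_S1 (N : ℕ) (α : ℝ) : (Hm N * S1 N α)ᴴ = Hm N * S1 N α := by
  rw [conjTranspose_mul, conjTranspose_S1, conjTranspose_Hm, neg_mul_neg, Hm_commute_S1]

theorem BS1_eq_fourierConj (N : ℕ) (α : ℝ) (x : Fin N → ℝ) :
    BS1 N α x = fourierConj N α x (S1 N α) := rfl

theorem BHS1_eq_fourierConj (N : ℕ) (α : ℝ) (x : Fin N → ℝ) :
    BHS1 N α x = fourierConj N α x (Hm N * S1 N α) := by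
  simp only [BHS1, fourierConj, Matrix.mul_assoc]

/-- The real bilinear form `Re ⟨A u, v⟩_h`. -/
noncomputable def iphReForm (N : ℕ) (α : ℝ) (x : Fin N → ℝ) (A : Matrix (Fin N) (Fin N) ℂ) :
    LinearMap.BilinForm ℝ (Fin N → ℂ) :=
  LinearMap.mk₂ ℝ (fun u v => (iph N α x (A *ᵥ u) v).re)
    (fun u u' v => by
      simp [iph, mulVec_add, mul_add, add_mul, Finset.sum_add_distrib])
    (fun c u v => by
      simp only [← Complex.coe_smul, mulVec_smul, iph, Pi.smul_apply, smul_eq_mul,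
        ← Complex.re_ofReal_mul]
      rw [mul_left_comm, Finset.mul_sum (s := Finset.univ) (a := (c : ℂ))]
      congr 2
      exact Finset.sum_congr rfl fun j _ => by ring)
    (fun u v v' => by
      simp [iph, mul_add, Finset.sum_add_distrib])
    (fun c u v => by
      simp only [← Complex.coe_smul, iph, Pi.smul_apply, smul_eq_mul, map_mul,
        Complex.conj_ofReal, ← Complex.re_ofReal_mul]
      rw [mul_left_comm, Finset.mul_sum (s := Finset.univ) (a := (c : ℂ))]
      congr 2
      exact Finset.sum_congr rfl fun j _ => by ring)

theorem iphReForm_apply (N : ℕ) (α : ℝ) (x : Fin N → ℝ) (A : Matrix (Fin N) (Fin N) ℂ)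
    (u v : Fin N → ℂ) : iphReForm N α x A u v = (iph N α x (A *ᵥ u) v).re := rfl

theorem iphReForm_one_comm (N : ℕ) (α : ℝ) (x : Fin N → ℝ) (u v : Fin N → ℂ) :
    iphReForm N α x 1 u v = iphReForm N α x 1 v u := by
  rw [iphReForm_apply, iphReForm_apply, one_mulVec, one_mulVec, ← iph_conj_symm, Complex.conj_re]

theorem iphReForm_one_BS1_self {N : ℕ} (hN0 : N ≠ 0) {α : ℝ} (hα : α ≠ 0) (x : Fin N → ℝ)
    (w : Fin N → ℂ) : iphReForm N α x 1 (BS1 N α x *ᵥ w) w = 0 := by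
  have hskew : iphReForm N α x 1 (BS1 N α x *ᵥ w) w
      = -iphReForm N α x 1 w (BS1 N α x *ᵥ w) := by
    rw [← map_neg, iphReForm_apply, iphReForm_apply, one_mulVec, one_mulVec, BS1_eq_fourierConj,
      iph_fourierConj_adjoint hN0 hα, conjTranspose_S1]
    simp [fourierConj, neg_mulVec]
  linarith [iphReForm_one_comm N α x w (BS1 N α x *ᵥ w)]

theorem iphReForm_BHS1_eq {N : ℕ} (hN0 : N ≠ 0) {α : ℝ} (hα : α ≠ 0) (x : Fin N → ℝ)
    (u v : Fin N → ℂ) :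
    iphReForm N α x (BHS1 N α x) u v = iphReForm N α x 1 u (BHS1 N α x *ᵥ v) := by
  rw [iphReForm_apply, iphReForm_apply, one_mulVec, BHS1_eq_fourierConj,
    iph_fourierConj_adjoint hN0 hα, conjTranspose_Hm_mul_S1]

theorem iphReForm_BHS1_comm {N : ℕ} (hN0 : N ≠ 0) {α : ℝ} (hα : α ≠ 0) (x : Fin N → ℝ)
    (u v : Fin N → ℂ) :
    iphReForm N α x (BHS1 N α x) u v = iphReForm N α x (BHS1 N α x) v u := by
  rw [iphReForm_BHS1_eq hN0 hα, iphReForm_one_comm, iphReForm_apply, iphReForm_apply, one_mulVec]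

/-- The SAV vector field is tangent to the level sets of the modified energy. -/
theorem iphReForm_BHS1_fSAV {N : ℕ} (hN0 : N ≠ 0) {α : ℝ} (hα : α ≠ 0) (x : Fin N → ℝ)
    (m : ℕ) (C0 : ℝ) (u : Fin N → ℝ) (v : ℝ) :
    iphReForm N α x (BHS1 N α x) (fSAV N α x m C0 u v) (cv N u)
      = 2 / (m * (m + 1)) * (gSAV N α x m C0 u v * (v : ℂ)).re := by
  set f := fSAV N α x m C0 u v with hf
  set ρ := Real.sqrt (rSAV N α x m C0 u) with hρ
  have horth : iphReForm N α x 1 f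
      (-(BHS1 N α x *ᵥ cv N u) + (1 / (m : ℝ) * (v / ρ)) • pw N m (cv N u)) = 0 := by
    have hfield : f = -(BS1 N α x *ᵥ
        (-(BHS1 N α x *ᵥ cv N u) + (1 / (m : ℝ) * (v / ρ)) • pw N m (cv N u))) := by
      rw [hf, fSAV, ← Complex.coe_smul]
      push_cast
      rfl
    rw [hfield, map_neg, LinearMap.neg_apply, iphReForm_one_BS1_self hN0 hα, neg_zero]
  rw [map_add, map_neg, map_smul, smul_eq_mul, iphReForm_one_comm N α x f (pw N m (cv N u)),
    iphReForm_apply N α x 1 (pw N m (cv N u)), one_mulVec] at horth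
  rw [iphReForm_BHS1_eq hN0 hα, gSAV, ← hf, ← hρ, Complex.re_mul_ofReal, Complex.re_ofReal_mul]
  have hm1 : (m : ℝ) + 1 ≠ 0 := by positivity
  have hcoeff : 2 / ((m : ℝ) * (m + 1)) * ((m + 1) / (2 * ρ)) = 1 / m * (1 / ρ) := by
    field_simp
  linear_combination -horth
    - (v * (iph N α x (pw N m (cv N u)) f).re) * hcoeff

theorem EhSAV_re (N : ℕ) (α : ℝ) (x : Fin N → ℝ) (m : ℕ) (C0 : ℝ) (u : Fin N → ℂ) (v : ℂ) :
    (EhSAV N α x m C0 u v).re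
      = 1 / 2 * iphReForm N α x (BHS1 N α x) u u
        - 1 / (m * (m + 1)) * ((v * v).re - C0) := by
  have hhalf : (1 / 2 : ℂ) = ((1 / 2 : ℝ) : ℂ) := by push_cast; rfl
  have hm : (1 / ((m : ℂ) * ((m : ℂ) + 1))) = ((1 / (m * (m + 1)) : ℝ) : ℂ) := by
    push_cast; rfl
  rw [EhSAV, hhalf, hm, Complex.sub_re, Complex.re_ofReal_mul, Complex.re_ofReal_mul,
    Complex.sub_re, Complex.ofReal_re, sq, iphReForm_apply]

/-- Theorem 3.4 (symplectic Runge–Kutta SAV energy conservation, fully discrete):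
under the symplecticity condition on the Runge–Kutta coefficients, the stage
positivity conditions, and the coupled SAV stage equations, the Runge–Kutta update
conserves the (real part of the) modified discrete energy exactly. -/
theorem srk_sav_energy_conservation (N : ℕ) (hN : Even N) (hN0 : 0 < N)
    (α : ℝ) (hα : 0 < α) (x : Fin N → ℝ) (m : ℕ) (hm : 1 ≤ m) (C0 : ℝ)
    (s : ℕ) (hs : 1 ≤ s) (a : Fin s → Fin s → ℝ) (b : Fin s → ℝ)
    (hab : ∀ i j, b i * a i j + b j * a j i = b i * b j)
    (τ : ℝ) (u0 : Fin N → ℝ) (v0 : ℝ)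
    (U : Fin s → Fin N → ℝ) (V : Fin s → ℝ)
    (hpos : ∀ i, 0 < rSAV N α x m C0 (U i))
    (hstageU : ∀ i, cv N (U i)
      = cv N u0 + (τ : ℂ) • ∑ j, (a i j : ℂ) • fSAV N α x m C0 (U j) (V j))
    (hstageV : ∀ i, (V i : ℂ)
      = (v0 : ℂ) + (τ : ℂ) * ∑ j, (a i j : ℂ) * gSAV N α x m C0 (U j) (V j)) :
    (EhSAV N α x m C0
        (cv N u0 + (τ : ℂ) • ∑ i, (b i : ℂ) • fSAV N α x m C0 (U i) (V i))
        ((v0 : ℂ) + (τ : ℂ) * ∑ i, (b i : ℂ) * gSAV N α x m C0 (U i) (V i))).re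
      = (EhSAV N α x m C0 (cv N u0) (v0 : ℂ)).re := by
  have hN' : N ≠ 0 := hN0.ne'
  simp only [Complex.coe_smul] at hstageU ⊢
  simp only [← Complex.real_smul] at hstageV ⊢
  have hu := symplectic_rungeKutta_quadratic (iphReForm_BHS1_comm hN' hα.ne' x) hab τ
    (cv N u0) hstageU
  have hv := symplectic_rungeKutta_quadratic
    (Φ := (LinearMap.mul ℝ ℂ).compr₂ Complex.reLm)
    (fun y z => congrArg Complex.re (mul_comm y z)) hab τ (v0 : ℂ) hstageV
  simp only [LinearMap.compr₂_apply, LinearMap.mul_apply', Complex.reLm_coe] at hv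
  simp only [iphReForm_BHS1_fSAV hN' hα.ne', mul_left_comm (b _), ← Finset.mul_sum] at hu
  rw [EhSAV_re, EhSAV_re, hu, hv]
  ring
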